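/- arXiv:1407.1546 — 7 statements merged into one kernel-verified Lean document; each statement's English description precedes it below -/
import Mathlib

section
/- Fix an integer k ≥ 1 and privacy parameters λ_1,…,λ_k ∈ ℝ with λ_i ≥ 1 for all i. For every finite transcript set 𝒯, every protocol-compatible {λ_i}-differentially private protocol P over 𝒯, every finite output set 𝒴, every accuracy-weight function W : {0,1}^k × 𝒴 → ℝ, and every row-stochastic decision rule Q ∈ [0,1]^{𝒯×𝒴}, the average accuracy satisfies 2^{-k} ∑_{x∈{0,1}^k} ∑_{τ∈𝒯} ∑_{y∈𝒴} W_{x,y} P_{x,τ} Q_{τ,y} ≤ 2^{-k} ∑_{x̃∈{0,1}^k} max_{y∈𝒴} ∑_{x∈{0,1}^k} W_{x,y} R_{x,x̃}, where R is the randomized response protocol; i.e., the randomized response with the optimal (deterministic, maximizing) decision rule maximizes the average accuracy of a central observer over all protocol-compatible {λ_i}-differentially private protocols and all decision rules. -/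
open Finset

/-- The single-coordinate decoding weights, a left inverse of the randomized response channel on
vectors `v` with `v a ≤ t * v b`. -/
noncomputable def decodeWeight (t : ℝ) (b a : Bool) : ℝ :=
  if t = 1 then (if b = a then 1 else 0) else (if b = a then t else -1) / (t - 1)

lemma sum_decodeWeight (t : ℝ) (b : Bool) : ∑ a, decodeWeight t b a = 1 := by
  by_cases ht : t = 1
  · cases b <;> simp [decodeWeight, ht]
  · have h : t - 1 ≠ 0 := sub_ne_zero.mpr ht
    cases b <;> simp [decodeWeight, ht] <;> field_simp <;> ring

lemma sum_decodeWeight_mul_nonneg {t : ℝ} (ht : 1 ≤ t) {v : Bool → ℝ} (hv : ∀ a, 0 ≤ v a)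
    (h : ∀ a b, v a ≤ t * v b) (b : Bool) : 0 ≤ ∑ a, decodeWeight t b a * v a := by
  by_cases ht1 : t = 1
  · cases b <;> simp [decodeWeight, ht1, hv]
  · have h0 : 0 < t - 1 := sub_pos.mpr (lt_of_le_of_ne ht (Ne.symm ht1))
    have h2 : ∑ a, decodeWeight t b a * v a = (t * v b - v (!b)) / (t - 1) := by
      cases b <;> simp [decodeWeight, ht1] <;> field_simp <;> ring
    rw [h2]
    exact div_nonneg (sub_nonneg.mpr (h _ _)) h0.le

lemma sum_sum_decodeWeight_mul_response {t : ℝ} (ht : 1 ≤ t) {v : Bool → ℝ}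
    (h : ∀ a b, v a ≤ t * v b) (c : Bool) :
    ∑ b, (∑ a, decodeWeight t b a * v a) * ((if b = c then t else 1) / (1 + t)) = v c := by
  have hp : 1 + t ≠ 0 := by positivity
  by_cases ht1 : t = 1
  · subst ht1
    have h1 := h true false
    have h2 := h false true
    cases c <;> simp [decodeWeight] <;> linarith
  · have h0 : t - 1 ≠ 0 := sub_ne_zero.mpr ht1
    cases c <;> simp [decodeWeight, ht1] <;> field_simp <;> ring

/-- A nonzero rank-one column satisfying the privacy constraints has factors satisfying them. -/
lemma factor_le_of_column_private {k : ℕ} {l : Fin k → ℝ} {u : Fin k → Bool → ℝ}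
    (hu : ∀ i b, 0 ≤ u i b)
    (hdp : ∀ (i : Fin k) (x x' : Fin k → Bool), (∀ j, j ≠ i → x j = x' j) →
      ∏ j, u j (x j) ≤ l i * ∏ j, u j (x' j))
    {x₀ : Fin k → Bool} (hx₀ : ∏ j, u j (x₀ j) ≠ 0) (i : Fin k) (a b : Bool) :
    u i a ≤ l i * u i b := by
  have hupd : ∀ c, ∏ j, u j (Function.update x₀ i c j) =
      u i c * ∏ j ∈ univ.erase i, u j (x₀ j) := fun c => by
    rw [← mul_prod_erase univ _ (mem_univ i), Function.update_self]
    congr 1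
    refine prod_congr rfl fun j hj => ?_
    rw [Function.update_of_ne (ne_of_mem_erase hj)]
  have hpos : 0 < ∏ j ∈ univ.erase i, u j (x₀ j) :=
    prod_pos fun j _ => lt_of_le_of_ne (hu _ _) (Ne.symm (prod_ne_zero_iff.mp hx₀ j (mem_univ j)))
  have h := hdp i (Function.update x₀ i a) (Function.update x₀ i b) fun j hj => by
    rw [Function.update_of_ne hj, Function.update_of_ne hj]
  rw [hupd, hupd, ← mul_assoc] at h
  exact le_of_mul_le_mul_right h hpos

/-- If `P` is obtained by post-processing the channel `R` with a stochastic matrix `C`, then no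
decision rule on `P` beats the optimal decision rule on `R`. -/
lemma accuracy_le_of_postprocessing {X S T Y : Type*} [Fintype X] [Fintype S] [Fintype T]
    [Fintype Y] [Nonempty Y] (P : X → T → ℝ) (R : X → S → ℝ) (C : S → T → ℝ)
    (hC : ∀ s τ, 0 ≤ C s τ) (hCrow : ∀ s, ∑ τ, C s τ = 1)
    (hP : ∀ x τ, P x τ = ∑ s, C s τ * R x s) (W : X → Y → ℝ)
    (Q : T → Y → ℝ) (hQ : ∀ τ y, 0 ≤ Q τ y) (hQrow : ∀ τ, ∑ y, Q τ y = 1) :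
    ∑ x, ∑ τ, ∑ y, W x y * P x τ * Q τ y ≤
      ∑ s, univ.sup' univ_nonempty (fun y => ∑ x, W x y * R x s) := by
  set M : S → ℝ := fun s => univ.sup' univ_nonempty (fun y => ∑ x, W x y * R x s)
  calc ∑ x, ∑ τ, ∑ y, W x y * P x τ * Q τ y
      = ∑ x, ∑ τ, ∑ y, ∑ s, C s τ * (Q τ y * (W x y * R x s)) := by
        refine sum_congr rfl fun x _ => sum_congr rfl fun τ _ => sum_congr rfl fun y _ => ?_
        rw [hP, mul_sum, sum_mul]
        exact sum_congr rfl fun s _ => by ring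
    _ = ∑ τ, ∑ y, ∑ s, ∑ x, C s τ * (Q τ y * (W x y * R x s)) := by
        rw [sum_comm]
        refine sum_congr rfl fun τ _ => ?_
        rw [sum_comm]
        exact sum_congr rfl fun y _ => sum_comm
    _ = ∑ τ, ∑ y, ∑ s, C s τ * (Q τ y * ∑ x, W x y * R x s) := by
        simp only [mul_sum]
    _ ≤ ∑ τ, ∑ y, ∑ s, C s τ * (Q τ y * M s) :=
        sum_le_sum fun τ _ => sum_le_sum fun y _ => sum_le_sum fun s _ =>
          mul_le_mul_of_nonneg_left (mul_le_mul_of_nonneg_left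
            (le_sup' (fun y => ∑ x, W x y * R x s) (mem_univ y)) (hQ _ _)) (hC _ _)
    _ = ∑ τ, ∑ s, C s τ * M s := by
        refine sum_congr rfl fun τ _ => ?_
        rw [sum_comm]
        refine sum_congr rfl fun s _ => ?_
        rw [← mul_sum, ← sum_mul, hQrow, one_mul]
    _ = ∑ s, M s := by
        rw [sum_comm]
        refine sum_congr rfl fun s _ => ?_
        rw [← sum_mul, hCrow, one_mul]

/-- **Optimality of randomized response for average accuracy (central observer).**
For any protocol-compatible `{λ_i}`-differentially private protocol `P` over a finite
transcript set and any row-stochastic decision rule `Q`, the average accuracy is at most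
that of the randomized response protocol with the optimal (maximizing) decision rule. -/
theorem randomized_response_optimal_average (k : ℕ) (hk : 1 ≤ k)
    (l : Fin k → ℝ) (hl : ∀ i, 1 ≤ l i)
    (T : Type*) [Fintype T] (P : (Fin k → Bool) → T → ℝ)
    (hPnn : ∀ x τ, 0 ≤ P x τ)
    (hProw : ∀ x, ∑ τ, P x τ = 1)
    (hPcompat : ∀ τ : T, ∃ u : Fin k → Bool → ℝ,
      (∀ i b, 0 ≤ u i b) ∧ ∀ x, P x τ = ∏ i, u i (x i))
    (hPdp : ∀ (i : Fin k) (x x' : Fin k → Bool) (τ : T),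
      (∀ j, j ≠ i → x j = x' j) → P x τ ≤ l i * P x' τ)
    (Y : Type*) [Fintype Y] [Nonempty Y]
    (W : (Fin k → Bool) → Y → ℝ)
    (Q : T → Y → ℝ) (hQnn : ∀ τ y, 0 ≤ Q τ y) (hQrow : ∀ τ, ∑ y, Q τ y = 1) :
    (2 : ℝ) ^ (-(k : ℤ)) * ∑ x : Fin k → Bool, ∑ τ : T, ∑ y : Y, W x y * P x τ * Q τ y ≤
      (2 : ℝ) ^ (-(k : ℤ)) * ∑ xt : Fin k → Bool,
        Finset.univ.sup' Finset.univ_nonempty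
          (fun y : Y => ∑ x : Fin k → Bool,
            W x y * ∏ i, (if xt i = x i then l i else 1) / (1 + l i)) := by
  set C : (Fin k → Bool) → T → ℝ := fun s τ =>
    ∑ x : Fin k → Bool, (∏ i, decodeWeight (l i) (s i) (x i)) * P x τ with hCdef
  have hCrow : ∀ s, ∑ τ, C s τ = 1 := fun s => by
    rw [sum_comm]
    simp only [← mul_sum, hProw, mul_one]
    rw [← Fintype.prod_sum (fun i a => decodeWeight (l i) (s i) a)]
    simp only [sum_decodeWeight, prod_const_one]
  have hcol : ∀ τ, (∀ s, 0 ≤ C s τ) ∧ ∀ x, P x τ =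
      ∑ s, C s τ * ∏ i, (if s i = x i then l i else 1) / (1 + l i) := fun τ => by
    by_cases hz : ∀ x, P x τ = 0
    · simp [hCdef, hz]
    obtain ⟨x₀, hx₀⟩ := not_forall.mp hz
    obtain ⟨u, hu, hPu⟩ := hPcompat τ
    have hle := factor_le_of_column_private (l := l) hu
      (fun i x x' hx => by simpa only [hPu] using hPdp i x x' τ hx) (hPu x₀ ▸ hx₀)
    have hCu : ∀ s, C s τ = ∏ i, ∑ a, decodeWeight (l i) (s i) a * u i a := fun s => by
      simp only [hCdef, hPu, ← prod_mul_distrib]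
      rw [Fintype.prod_sum (fun i a => decodeWeight (l i) (s i) a * u i a)]
    refine ⟨fun s => ?_, fun x => ?_⟩
    · rw [hCu]
      exact prod_nonneg fun i _ => sum_decodeWeight_mul_nonneg (hl i) (hu i) (hle i) (s i)
    · simp only [hCu, ← prod_mul_distrib]
      rw [← Fintype.prod_sum (fun i b => (∑ a, decodeWeight (l i) b a * u i a) *
        ((if b = x i then l i else 1) / (1 + l i))), hPu]
      exact prod_congr rfl fun i _ =>
        (sum_sum_decodeWeight_mul_response (hl i) (hle i) (x i)).symm
  clear_value C
  choose hC hP using hcol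
  have hmain := accuracy_le_of_postprocessing P
    (fun x s => ∏ i, (if s i = x i then l i else 1) / (1 + l i)) C
    (fun s τ => hC τ s) hCrow (fun x τ => by convert hP τ x) W Q hQnn hQrow
  have h2 : (0 : ℝ) ≤ 2 ^ (-(k : ℤ)) := by positivity
  exact mul_le_mul_of_nonneg_left hmain h2
end

section
/- Fix an integer k ≥ 1, privacy parameters λ_1,…,λ_k ∈ ℝ with λ_i ≥ 1, a finite output set 𝒴, and accuracy weights W : {0,1}^k × 𝒴 → ℝ. There exists a row-stochastic decision rule Q* ∈ [0,1]^{{0,1}^k × 𝒴} for the randomized response protocol R such that for every finite transcript set 𝒯, every protocol-compatible {λ_i}-differentially private protocol P over 𝒯, and every row-stochastic decision rule Q ∈ [0,1]^{𝒯×𝒴}, the worst-case accuracies satisfy min_{x∈{0,1}^k} ∑_{τ∈𝒯} ∑_{y∈𝒴} W_{x,y} P_{x,τ} Q_{τ,y} ≤ min_{x∈{0,1}^k} ∑_{x̃∈{0,1}^k} ∑_{y∈𝒴} W_{x,y} R_{x,x̃} Q*_{x̃,y}; i.e., the randomized response with an optimal (possibly randomized) decision rule maximizes the worst-case accuracy of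 a central observer over all protocol-compatible {λ_i}-differentially private protocols and all decision rules. -/
open Finset

/-- The transition probabilities of randomized response. -/
noncomputable def rrKernel {k : ℕ} (l : Fin k → ℝ) (x xt : Fin k → Bool) : ℝ :=
  ∏ i, (if xt i = x i then l i else 1) / (1 + l i)

/-- A right inverse of one-bit randomized response with parameter `a`; for `a = 1`, where the
channel is constant, it is the identity, which inverts the channel on constant vectors. -/
noncomputable def bitInv (a : ℝ) (c b : Bool) : ℝ :=
  if a = 1 then (if c = b then 1 else 0) else (if c = b then a else -1) / (a - 1)

/-- The tensor product of the one-bit inverses. -/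
noncomputable def rrInv {k : ℕ} (l : Fin k → ℝ) (xt x : Fin k → Bool) : ℝ :=
  ∏ i, bitInv (l i) (xt i) (x i)

lemma sum_bitInv (a : ℝ) (c : Bool) : ∑ b, bitInv a c b = 1 := by
  by_cases h : a = 1
  · cases c <;> simp [bitInv, h]
  · have : a - 1 ≠ 0 := sub_ne_zero.2 h
    cases c <;> simp [bitInv, h] <;> field_simp <;> ring

lemma bitInv_sum_nonneg {a : ℝ} (ha : 1 ≤ a) {u : Bool → ℝ} (hu : ∀ b, 0 ≤ u b)
    (h : ∀ b b', u b ≤ a * u b') (c : Bool) : 0 ≤ ∑ b, bitInv a c b * u b := by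
  by_cases h1 : a = 1
  · cases c <;> simp [bitInv, h1, hu]
  · have : 0 < a - 1 := sub_pos.2 (lt_of_le_of_ne ha (Ne.symm h1))
    have key : ∑ b, bitInv a c b * u b = (a * u c - u (!c)) / (a - 1) := by
      cases c <;> simp [bitInv, h1] <;> ring
    rw [key]
    exact div_nonneg (sub_nonneg.2 (h _ _)) this.le

lemma bit_reconstruct {a : ℝ} (ha : 1 ≤ a) {u : Bool → ℝ}
    (h : ∀ b b', u b ≤ a * u b') (b : Bool) :
    ∑ c, (if c = b then a else 1) / (1 + a) * ∑ b', bitInv a c b' * u b' = u b := by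
  by_cases h1 : a = 1
  · subst h1
    have h2 : u true = u false :=
      le_antisymm (by simpa using h true false) (by simpa using h false true)
    cases b <;> simp [bitInv, h2] <;> ring
  · have : a - 1 ≠ 0 := sub_ne_zero.2 h1
    have : 1 + a ≠ 0 := by positivity
    cases b <;> simp [bitInv, h1] <;> field_simp <;> ring

lemma sum_pi_prod {k : ℕ} (f : Fin k → Bool → ℝ) :
    ∑ x : Fin k → Bool, ∏ i, f i (x i) = ∏ i, ∑ b, f i b := by
  rw [Finset.prod_univ_sum, Fintype.piFinset_univ]

lemma sum_rrInv {k : ℕ} (l : Fin k → ℝ) (xt : Fin k → Bool) : ∑ x, rrInv l xt x = 1 := by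
  simp only [rrInv]
  rw [sum_pi_prod (fun i b => bitInv (l i) (xt i) b)]
  exact Finset.prod_eq_one fun i _ => sum_bitInv _ _

lemma rrInv_sum_prod {k : ℕ} (l : Fin k → ℝ) (u : Fin k → Bool → ℝ) (xt : Fin k → Bool) :
    ∑ x, rrInv l xt x * ∏ i, u i (x i) = ∏ i, ∑ b, bitInv (l i) (xt i) b * u i b := by
  simp only [rrInv, ← Finset.prod_mul_distrib]
  exact sum_pi_prod (fun i b => bitInv (l i) (xt i) b * u i b)

/-- The factors of a nonzero rank-one differentially private column satisfy the one-bit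
privacy constraints. -/
lemma factor_le {k : ℕ} {l : Fin k → ℝ} {p : (Fin k → Bool) → ℝ} {u : Fin k → Bool → ℝ}
    (hu : ∀ i b, 0 ≤ u i b) (hp : ∀ x, p x = ∏ i, u i (x i))
    (hdp : ∀ (i : Fin k) (x x' : Fin k → Bool),
      (∀ j, j ≠ i → x j = x' j) → p x ≤ l i * p x')
    {x : Fin k → Bool} (hx : p x ≠ 0) (i : Fin k) (b b' : Bool) :
    u i b ≤ l i * u i b' := by
  have hpos : 0 < ∏ j ∈ univ.erase i, u j (x j) := by
    refine Finset.prod_pos fun j _ => lt_of_le_of_ne (hu _ _) fun h => hx ?_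
    rw [hp]
    exact Finset.prod_eq_zero (mem_univ j) h.symm
  have key (c : Bool) :
      p (Function.update x i c) = u i c * ∏ j ∈ univ.erase i, u j (x j) := by
    rw [hp, ← Finset.mul_prod_erase univ _ (mem_univ i), Function.update_self]
    congr 1
    refine Finset.prod_congr rfl fun j hj => ?_
    rw [Function.update_of_ne (Finset.ne_of_mem_erase hj)]
  have h := hdp i (Function.update x i b) (Function.update x i b') fun j hj => by
    rw [Function.update_of_ne hj, Function.update_of_ne hj]
  rw [key, key, ← mul_assoc] at h
  exact le_of_mul_le_mul_right h hpos

/-- Every rank-one differentially private column is a nonnegative combination of the columns of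
randomized response, with coefficients given by `rrInv`. -/
lemma column_factorization {k : ℕ} {l : Fin k → ℝ} (hl : ∀ i, 1 ≤ l i)
    {p : (Fin k → Bool) → ℝ} {u : Fin k → Bool → ℝ}
    (hu : ∀ i b, 0 ≤ u i b) (hp : ∀ x, p x = ∏ i, u i (x i))
    (hdp : ∀ (i : Fin k) (x x' : Fin k → Bool),
      (∀ j, j ≠ i → x j = x' j) → p x ≤ l i * p x') :
    (∀ xt, 0 ≤ ∑ x, rrInv l xt x * p x) ∧
      ∀ x, ∑ xt, rrKernel l x xt * ∑ x', rrInv l xt x' * p x' = p x := by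
  by_cases h0 : ∀ x, p x = 0
  · simp [h0]
  · push Not at h0
    obtain ⟨x₀, hx₀⟩ := h0
    have hle := factor_le hu hp hdp hx₀
    simp only [hp, rrInv_sum_prod]
    refine ⟨fun xt => Finset.prod_nonneg fun i _ =>
      bitInv_sum_nonneg (hl i) (hu i) (hle i) (xt i), fun x => ?_⟩
    simp only [rrKernel, ← Finset.prod_mul_distrib]
    rw [sum_pi_prod (fun i c => (if c = x i then l i else 1) / (1 + l i) *
      ∑ b, bitInv (l i) c b * u i b)]
    exact Finset.prod_congr rfl fun i _ => bit_reconstruct (hl i) (hle i) (x i)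

/-- Some decision rule attains the largest worst-case accuracy for a given protocol. -/
lemma exists_optimal_decision {X S Y : Type*} [Fintype X] [Nonempty X] [Fintype S]
    [Fintype Y] [Nonempty Y] (W : X → Y → ℝ) (R : X → S → ℝ) :
    ∃ Qs : S → Y → ℝ, (∀ s y, 0 ≤ Qs s y) ∧ (∀ s, ∑ y, Qs s y = 1) ∧
      ∀ Q : S → Y → ℝ, (∀ s y, 0 ≤ Q s y) → (∀ s, ∑ y, Q s y = 1) →
        univ.inf' univ_nonempty (fun x => ∑ s, ∑ y, W x y * R x s * Q s y) ≤
        univ.inf' univ_nonempty (fun x => ∑ s, ∑ y, W x y * R x s * Qs s y) := by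
  classical
  have hc : IsCompact (Set.univ.pi fun _ : S => stdSimplex ℝ Y) :=
    isCompact_univ_pi fun _ => isCompact_stdSimplex ℝ Y
  have hne : (Set.univ.pi fun _ : S => stdSimplex ℝ Y).Nonempty :=
    ⟨fun _ => Pi.single (Classical.arbitrary Y) 1, fun _ _ => single_mem_stdSimplex ℝ _⟩
  have hcont : Continuous fun Q : S → Y → ℝ =>
      univ.inf' univ_nonempty (fun x => ∑ s, ∑ y, W x y * R x s * Q s y) :=
    Continuous.finset_inf'_apply _ fun x _ => by fun_prop
  obtain ⟨Qs, hQs, hmax⟩ := hc.exists_isMaxOn hne hcont.continuousOn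
  exact ⟨Qs, fun s => (hQs s trivial).1, fun s => (hQs s trivial).2,
    fun Q h0 h1 => hmax fun s _ => ⟨h0 s, h1 s⟩⟩

/-- **Optimality of randomized response for worst-case accuracy (central observer).**
There is a row-stochastic decision rule `Qs` for the randomized response protocol such that
no protocol-compatible `{λ_i}`-differentially private protocol with any decision rule
achieves a larger worst-case accuracy. -/
theorem randomized_response_optimal_worst_case (k : ℕ) (hk : 1 ≤ k)
    (l : Fin k → ℝ) (hl : ∀ i, 1 ≤ l i)
    (Y : Type*) [Fintype Y] [Nonempty Y]
    (W : (Fin k → Bool) → Y → ℝ) :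
    ∃ Qs : (Fin k → Bool) → Y → ℝ,
      (∀ xt y, 0 ≤ Qs xt y) ∧ (∀ xt, ∑ y, Qs xt y = 1) ∧
      ∀ (T : Type) [Fintype T], ∀ P : (Fin k → Bool) → T → ℝ,
        (∀ x τ, 0 ≤ P x τ) →
        (∀ x, ∑ τ, P x τ = 1) →
        (∀ τ : T, ∃ u : Fin k → Bool → ℝ,
          (∀ i b, 0 ≤ u i b) ∧ ∀ x, P x τ = ∏ i, u i (x i)) →
        (∀ (i : Fin k) (x x' : Fin k → Bool) (τ : T),
          (∀ j, j ≠ i → x j = x' j) → P x τ ≤ l i * P x' τ) →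
        ∀ Q : T → Y → ℝ, (∀ τ y, 0 ≤ Q τ y) → (∀ τ, ∑ y, Q τ y = 1) →
          Finset.univ.inf' Finset.univ_nonempty
            (fun x : Fin k → Bool => ∑ τ : T, ∑ y : Y, W x y * P x τ * Q τ y) ≤
          Finset.univ.inf' Finset.univ_nonempty
            (fun x : Fin k → Bool => ∑ xt : Fin k → Bool, ∑ y : Y,
              W x y * (∏ i, (if xt i = x i then l i else 1) / (1 + l i)) * Qs xt y) := by
  obtain ⟨Qs, h0, h1, hopt⟩ := exists_optimal_decision W (rrKernel l)
  refine ⟨Qs, h0, h1, fun T _ P _ hPs hPc hPd Q hQ0 hQ1 => ?_⟩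
  have hcol (τ : T) : (∀ xt, 0 ≤ ∑ x, rrInv l xt x * P x τ) ∧
      ∀ x, ∑ xt, rrKernel l x xt * ∑ x', rrInv l xt x' * P x' τ = P x τ := by
    obtain ⟨u, hu, hp⟩ := hPc τ
    exact column_factorization (p := fun x => P x τ) hl hu hp
      fun i x x' h => hPd i x x' τ h
  have hM (xt : Fin k → Bool) : ∑ τ, ∑ x, rrInv l xt x * P x τ = 1 := by
    rw [Finset.sum_comm]
    simp only [← Finset.mul_sum, hPs, mul_one, sum_rrInv]
  have hmain := hopt (fun xt y => ∑ τ, (∑ x, rrInv l xt x * P x τ) * Q τ y)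
    (fun xt y => Finset.sum_nonneg fun τ _ => mul_nonneg ((hcol τ).1 xt) (hQ0 τ y))
    (fun xt => by
      rw [Finset.sum_comm]
      simp only [← Finset.mul_sum, hQ1, mul_one, hM])
  refine le_trans (le_of_eq ?_) hmain
  congr 1
  funext x
  calc ∑ τ, ∑ y, W x y * P x τ * Q τ y
      = ∑ τ, ∑ y, ∑ xt, W x y * rrKernel l x xt *
          ((∑ x', rrInv l xt x' * P x' τ) * Q τ y) := by
        refine Finset.sum_congr rfl fun τ _ => Finset.sum_congr rfl fun y _ => ?_
        rw [← (hcol τ).2 x, Finset.mul_sum, Finset.sum_mul]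
        refine Finset.sum_congr rfl fun xt _ => ?_
        ring
    _ = ∑ y, ∑ xt, ∑ τ, W x y * rrKernel l x xt *
          ((∑ x', rrInv l xt x' * P x' τ) * Q τ y) := by
        rw [Finset.sum_comm]
        exact Finset.sum_congr rfl fun y _ => Finset.sum_comm
    _ = _ := by
        rw [Finset.sum_comm]
        simp only [Finset.mul_sum]
end

section
/- Fix an integer k ≥ 1, privacy parameters λ_1,…,λ_k ∈ ℝ with λ_i ≥ 1, an index i ∈ [k], a finite output set 𝒴, and accuracy weights W : {0,1}^k × 𝒴 → ℝ. For every finite transcript set 𝒯, every protocol-compatible {λ_i}-differentially private protocol P over 𝒯, and every party-i decision rule Q (i.e., Q_{τ,b,y} ≥ 0 with ∑_{y∈𝒴} Q_{τ,b,y} = 1 for each τ ∈ 𝒯 and b ∈ {0,1}), the average accuracy of party i satisfies 2^{-k} ∑_{x∈{0,1}^k} ∑_{τ∈𝒯} ∑_{y∈𝒴} W_{x,y} P_{x,τ} Q_{τ,x_i,y} ≤ 2^{-k} ∑_{b∈{0,1}} ∑_{x̃∈{0,1}^k} max_{y∈𝒴} ∑_{x∈{0,1}^k : x_i = b} W_{x,y}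 R_{x,x̃}, where R is the randomized response protocol; i.e., the randomized response with the optimal decision rule (which may depend on party i's own bit x_i) maximizes party i's average accuracy over all protocol-compatible {λ_i}-differentially private protocols and all decision rules. -/
open Finset

/-- The entries of the randomized response on one bit with privacy parameter `l`. -/
noncomputable def bitResponse (l : ℝ) (a b : Bool) : ℝ := (if a = b then l else 1) / (1 + l)

/-- A matrix with unit row sums, inverting `bitResponse l` when `l ≠ 1`, and averaging over the
two bits when `l = 1`. -/
noncomputable def bitResponseInv (l : ℝ) (a b : Bool) : ℝ :=
  if l = 1 then 1 / 2 else (if a = b then l else -1) / (l - 1)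

lemma sum_bitResponseInv (l : ℝ) (a : Bool) : ∑ b, bitResponseInv l a b = 1 := by
  rw [Fintype.sum_bool]
  unfold bitResponseInv
  split_ifs with h
  · norm_num
  all_goals
    have : l - 1 ≠ 0 := sub_ne_zero.2 h
    cases a <;> simp_all <;> field_simp <;> ring

lemma sum_bitResponseInv_mul_nonneg {l : ℝ} (hl : 1 ≤ l) {u : Bool → ℝ}
    (hu : ∀ b, 0 ≤ u b) (hdp : ∀ b b', u b ≤ l * u b') (a : Bool) :
    0 ≤ ∑ b, bitResponseInv l a b * u b := by
  rw [Fintype.sum_bool]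
  unfold bitResponseInv
  by_cases h : l = 1
  · simp only [h, if_true]
    linarith [hu true, hu false]
  · have hpos : 0 < l - 1 := sub_pos.2 (lt_of_le_of_ne hl (Ne.symm h))
    simp only [h, if_false, div_mul_eq_mul_div, ← add_div]
    apply div_nonneg _ hpos.le
    cases a <;> simp <;> linarith [hdp true false, hdp false true]

lemma sum_bitResponse_mul_bitResponseInv {l : ℝ} (hl : 1 ≤ l) {u : Bool → ℝ}
    (hdp : ∀ b b', u b ≤ l * u b') (b : Bool) :
    ∑ a, bitResponse l a b * ∑ b', bitResponseInv l a b' * u b' = u b := by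
  have h1 := hdp true false
  have h2 := hdp false true
  simp only [Fintype.sum_bool]
  unfold bitResponse bitResponseInv
  have hp : 1 + l ≠ 0 := by linarith
  by_cases h : l = 1
  · subst h
    have : u true = u false := by linarith
    cases b <;> simp [this] <;> ring
  · have hm : l - 1 ≠ 0 := sub_ne_zero.2 h
    cases b <;> simp [h] <;> field_simp <;> ring

/-- A rank-one tensor satisfying the privacy constraints is a product of vectors each of which
satisfies the privacy constraint of its own coordinate. -/
lemma exists_private_factors {ι : Type*} [Fintype ι] [DecidableEq ι] [Nonempty ι]
    {l : ι → ℝ} {p : (ι → Bool) → ℝ}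
    (hcompat : ∃ u : ι → Bool → ℝ, (∀ j b, 0 ≤ u j b) ∧ ∀ x, p x = ∏ j, u j (x j))
    (hdp : ∀ (j : ι) (x x' : ι → Bool), (∀ m, m ≠ j → x m = x' m) → p x ≤ l j * p x') :
    ∃ u : ι → Bool → ℝ, (∀ j b, 0 ≤ u j b) ∧ (∀ j b b', u j b ≤ l j * u j b') ∧
      ∀ x, p x = ∏ j, u j (x j) := by
  obtain ⟨u, hu, hpu⟩ := hcompat
  by_cases hz : ∀ x, p x = 0
  · exact ⟨fun _ _ => 0, by simp, by simp, fun x => by simp [hz x]⟩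
  push Not at hz
  obtain ⟨z, hz⟩ := hz
  refine ⟨u, hu, fun j b b' => ?_, hpu⟩
  have hne : ∀ m, u m (z m) ≠ 0 := fun m hm => hz <| by
    rw [hpu]
    exact prod_eq_zero (mem_univ m) hm
  have hpos : 0 < ∏ m ∈ univ.erase j, u m (z m) :=
    prod_pos fun m _ => lt_of_le_of_ne (hu _ _) (hne m).symm
  have key : ∀ c, p (Function.update z j c) = u j c * ∏ m ∈ univ.erase j, u m (z m) := by
    intro c
    rw [hpu, ← mul_prod_erase univ _ (mem_univ j), Function.update_self]
    congr 1
    exact prod_congr rfl fun m hm => by rw [Function.update_of_ne (ne_of_mem_erase hm)]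
  have h := hdp j (Function.update z j b) (Function.update z j b')
    fun m hm => by simp [Function.update_of_ne hm]
  rw [key, key, ← mul_assoc] at h
  exact le_of_mul_le_mul_right h hpos

/-- Every private protocol-compatible matrix is a post-processing of the randomized response. -/
lemma exists_stochastic_factorization {ι T : Type*} [Fintype ι] [DecidableEq ι] [Nonempty ι]
    [Fintype T] {l : ι → ℝ} (hl : ∀ j, 1 ≤ l j) {P : (ι → Bool) → T → ℝ}
    (hrow : ∀ x, ∑ τ, P x τ = 1)
    (hcompat : ∀ τ : T, ∃ u : ι → Bool → ℝ,
      (∀ j b, 0 ≤ u j b) ∧ ∀ x, P x τ = ∏ j, u j (x j))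
    (hdp : ∀ (j : ι) (x x' : ι → Bool) (τ : T),
      (∀ m, m ≠ j → x m = x' m) → P x τ ≤ l j * P x' τ) :
    ∃ C : (ι → Bool) → T → ℝ, (∀ z τ, 0 ≤ C z τ) ∧ (∀ z, ∑ τ, C z τ = 1) ∧
      ∀ x τ, P x τ = ∑ z, (∏ j, bitResponse (l j) (z j) (x j)) * C z τ := by
  choose u hu hul hPu using fun τ =>
    exists_private_factors (hcompat τ) fun j x x' => hdp j x x' τ
  have hC : ∀ (z : ι → Bool) (τ : T), ∑ x : ι → Bool, (∏ j, bitResponseInv (l j) (z j) (x j)) * P x τ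
      = ∏ j, ∑ b, bitResponseInv (l j) (z j) b * u τ j b := by
    intro z τ
    simp_rw [hPu, ← prod_mul_distrib]
    exact (Fintype.prod_sum fun j b => bitResponseInv (l j) (z j) b * u τ j b).symm
  refine ⟨fun z τ => ∑ x, (∏ j, bitResponseInv (l j) (z j) (x j)) * P x τ,
    fun z τ => ?_, fun z => ?_, fun x τ => ?_⟩
  · simp only [hC]
    exact prod_nonneg fun j _ => sum_bitResponseInv_mul_nonneg (hl j) (hu τ j) (hul τ j) _
  · rw [sum_comm]
    simp_rw [← mul_sum, hrow, mul_one]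
    rw [← Fintype.prod_sum fun j b => bitResponseInv (l j) (z j) b]
    exact prod_eq_one fun j _ => sum_bitResponseInv _ _
  · simp only [hC, ← prod_mul_distrib]
    rw [← Fintype.prod_sum fun j a =>
      bitResponse (l j) a (x j) * ∑ b, bitResponseInv (l j) a b * u τ j b]
    simp_rw [fun j => sum_bitResponse_mul_bitResponseInv (hl j) (hul τ j) (x j)]
    exact hPu τ x

/-- **Optimality of randomized response for party `i`'s average accuracy.**
For any protocol-compatible `{λ_i}`-differentially private protocol `P` and any party-`i`
decision rule `Q` (which may depend on party `i`'s own bit), the average accuracy of party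
`i` is at most that of the randomized response with the optimal decision rule. -/
theorem randomized_response_optimal_average_party (k : ℕ) (hk : 1 ≤ k)
    (l : Fin k → ℝ) (hl : ∀ i, 1 ≤ l i) (i : Fin k)
    (Y : Type*) [Fintype Y] [Nonempty Y]
    (W : (Fin k → Bool) → Y → ℝ)
    (T : Type*) [Fintype T] (P : (Fin k → Bool) → T → ℝ)
    (hPnn : ∀ x τ, 0 ≤ P x τ)
    (hProw : ∀ x, ∑ τ, P x τ = 1)
    (hPcompat : ∀ τ : T, ∃ u : Fin k → Bool → ℝ,
      (∀ j b, 0 ≤ u j b) ∧ ∀ x, P x τ = ∏ j, u j (x j))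
    (hPdp : ∀ (j : Fin k) (x x' : Fin k → Bool) (τ : T),
      (∀ m, m ≠ j → x m = x' m) → P x τ ≤ l j * P x' τ)
    (Q : T → Bool → Y → ℝ)
    (hQnn : ∀ τ b y, 0 ≤ Q τ b y) (hQrow : ∀ τ b, ∑ y, Q τ b y = 1) :
    (2 : ℝ) ^ (-(k : ℤ)) * ∑ x : Fin k → Bool, ∑ τ : T, ∑ y : Y,
        W x y * P x τ * Q τ (x i) y ≤
      (2 : ℝ) ^ (-(k : ℤ)) * ∑ b : Bool, ∑ xt : Fin k → Bool,
        Finset.univ.sup' Finset.univ_nonempty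
          (fun y : Y => ∑ x ∈ Finset.univ.filter (fun x : Fin k → Bool => x i = b),
            W x y * ∏ j, (if xt j = x j then l j else 1) / (1 + l j)) := by
  have : Nonempty (Fin k) := ⟨i⟩
  obtain ⟨C, hC, hCrow, hPC⟩ := exists_stochastic_factorization hl hProw hPcompat hPdp
  refine mul_le_mul_of_nonneg_left ?_ (by positivity)
  set S : Bool → (Fin k → Bool) → Y → ℝ := fun b z y =>
    ∑ x ∈ univ.filter (fun x : Fin k → Bool => x i = b),
      W x y * ∏ j, (if z j = x j then l j else 1) / (1 + l j) with hS
  have hsum : ∑ x, ∑ τ, ∑ y, W x y * P x τ * Q τ (x i) y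
      = ∑ b, ∑ z, ∑ τ, C z τ * ∑ y, Q τ b y * S b z y := by
    rw [← sum_fiberwise univ (fun x : Fin k → Bool => x i)]
    refine sum_congr rfl fun b _ => ?_
    calc ∑ x ∈ univ.filter (fun x : Fin k → Bool => x i = b),
          ∑ τ, ∑ y, W x y * P x τ * Q τ (x i) y
        = ∑ x ∈ univ.filter (fun x : Fin k → Bool => x i = b), ∑ τ, ∑ y, ∑ z,
            C z τ * (Q τ b y *
              (W x y * ∏ j, (if z j = x j then l j else 1) / (1 + l j))) := by
          refine sum_congr rfl fun x hx => sum_congr rfl fun τ _ => sum_congr rfl fun y _ => ?_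
          rw [(mem_filter.1 hx).2, hPC, mul_sum, sum_mul]
          refine sum_congr rfl fun z _ => ?_
          simp only [bitResponse]
          ring
      _ = ∑ z, ∑ τ, C z τ * ∑ y, Q τ b y * S b z y := by
          simp only [hS, mul_sum]
          rw [sum_comm, sum_comm (s := univ (α := Fin k → Bool))]
          refine sum_congr rfl fun τ _ => ?_
          rw [sum_comm, sum_comm (s := univ (α := Fin k → Bool))]
          refine sum_congr rfl fun y _ => ?_
          rw [sum_comm]
  rw [hsum]
  refine sum_le_sum fun b _ => sum_le_sum fun z _ => ?_
  calc ∑ τ, C z τ * ∑ y, Q τ b y * S b z y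
      ≤ ∑ τ, C z τ * univ.sup' univ_nonempty (S b z) := by
        refine sum_le_sum fun τ _ => mul_le_mul_of_nonneg_left ?_ (hC z τ)
        calc ∑ y, Q τ b y * S b z y
            ≤ ∑ y, Q τ b y * univ.sup' univ_nonempty (S b z) :=
              sum_le_sum fun y _ =>
                mul_le_mul_of_nonneg_left (le_sup' (S b z) (mem_univ y)) (hQnn τ b y)
          _ = univ.sup' univ_nonempty (S b z) := by rw [← sum_mul, hQrow, one_mul]
    _ = univ.sup' univ_nonempty (S b z) := by rw [← sum_mul, hCrow, one_mul]
end

section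
/- Fix an integer k ≥ 1 and λ_1,…,λ_k ∈ ℝ with λ_i > 1. The convex hull of the manifold ℳ of rank-one tensors equals the set of all T ∈ ℝ^{{0,1}^k} such that T_{(0,…,0)} = 1 and T ∈ H_a for every sign pattern a ∈ {−1,+1}^k; i.e., conv(ℳ) = { T : T_{0⋯0} = 1 } ∩ ⋂_{a∈{−1,+1}^k} H_a. -/
open Finset

/-- The affine functional defining a half-space, as a sum of products over the coordinates. -/
lemma sign_mul_sum_eq_sum_mul_prod {k : ℕ} (s : Fin k → ℝ) (T : (Fin k → Bool) → ℝ)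
    (g : (Fin k → Bool) → Fin k → ℝ) :
    (-1 : ℝ) ^ k * (∏ i, s i) * ∑ x, T x * ∏ i, g x i = ∑ x, T x * ∏ i, (-s i * g x i) := by
  simp only [prod_mul_distrib, prod_neg, card_univ, Fintype.card_fin, mul_sum]
  exact sum_congr rfl fun x _ => by ring

/-- Evaluating a multilinear form with coefficients `c` at a rank-one tensor. -/
lemma sum_prod_ite_mul_prod_ite {ι : Type*} [Fintype ι] [DecidableEq ι] (t c : ι → ℝ) :
    ∑ x : ι → Bool, (∏ i, if x i then t i else 1) * ∏ i, (if x i then -c i else 1)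
      = ∏ i, (1 - c i * t i) := by
  have h := Fintype.prod_sum fun (i : ι) (b : Bool) =>
    (if b then t i else 1) * (if b then -c i else 1)
  simp only [prod_mul_distrib] at h
  rw [← h]
  exact prod_congr rfl fun i _ => by rw [Fintype.sum_bool]; simp; ring

/-- The normalized functionals are dual to the endpoints `l` and `l⁻¹`, one coordinate at a time. -/
lemma sum_bool_dual {l : ℝ} (hl : 1 < l) (x y : Bool) :
    ∑ a : Bool, (-(if a then (1 : ℝ) else -1) * (if x then -(if a then l else l⁻¹) else 1)) /
        ((if a then (1 : ℝ) else -1) * ((if a then l else l⁻¹) ^ 2 - 1)) *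
        (if y then (if a then l else l⁻¹) else 1) = if x = y then 1 else 0 := by
  have h0 : l ≠ 0 := by positivity
  have h1 : l ^ 2 - 1 ≠ 0 := by nlinarith
  have h2 : l⁻¹ ^ 2 - 1 = -((l ^ 2 - 1) / l ^ 2) := by field_simp; ring
  cases x <;> cases y <;>
    simp only [Fintype.sum_bool, if_true, if_false, Bool.false_eq_true, Bool.true_eq_false, h2] <;>
    field_simp <;> ring

lemma sum_prod_dual {ι : Type*} [Fintype ι] [DecidableEq ι] {l : ι → ℝ} (hl : ∀ i, 1 < l i)
    (x y : ι → Bool) :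
    ∑ a : ι → Bool, ∏ i,
      ((-(if a i then (1 : ℝ) else -1) * (if x i then -(if a i then l i else (l i)⁻¹) else 1)) /
        ((if a i then (1 : ℝ) else -1) * ((if a i then l i else (l i)⁻¹) ^ 2 - 1)) *
        (if y i then (if a i then l i else (l i)⁻¹) else 1)) = if x = y then 1 else 0 := by
  rw [← Fintype.prod_sum fun (i : ι) (b : Bool) =>
    ((-(if b then (1 : ℝ) else -1) * (if x i then -(if b then l i else (l i)⁻¹) else 1)) /
        ((if b then (1 : ℝ) else -1) * ((if b then l i else (l i)⁻¹) ^ 2 - 1)) *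
        (if y i then (if b then l i else (l i)⁻¹) else 1))]
  simp only [sum_bool_dual (hl _), prod_ite_zero, prod_const_one, mem_univ, true_imp_iff,
    funext_iff]

/-- **Characterization of the convex hull of the manifold of rank-one tensors.**
The convex hull of the manifold `ℳ = {T : T_x = ∏ t_i^{x_i}, λ_i⁻¹ ≤ t_i ≤ λ_i}` equals
the intersection of the hyperplane `{T : T_{0⋯0} = 1}` with all half-spaces `H_a`,
`a ∈ {−1,+1}^k`. A sign pattern `a : Fin k → Bool` encodes `a_i = +1` as `true`
(so `λ_i^{a_i} = λ_i`) and `a_i = −1` as `false` (so `λ_i^{a_i} = λ_i⁻¹`). -/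
theorem convexHull_manifold_eq_polytope (k : ℕ) (hk : 1 ≤ k)
    (l : Fin k → ℝ) (hl : ∀ i, 1 < l i) :
    convexHull ℝ {T : (Fin k → Bool) → ℝ | ∃ t : Fin k → ℝ,
        (∀ i, (l i)⁻¹ ≤ t i ∧ t i ≤ l i) ∧ ∀ x, T x = ∏ i, if x i then t i else 1}
      = {T : (Fin k → Bool) → ℝ | T (fun _ => false) = 1} ∩
        ⋂ a : Fin k → Bool,
          {T : (Fin k → Bool) → ℝ |
            0 ≤ (-1 : ℝ) ^ k * (∏ i, if a i then (1 : ℝ) else -1) *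
              ∑ x : Fin k → Bool,
                T x * ∏ i, (if x i then -(if a i then l i else (l i)⁻¹) else 1)} := by
  have hpos : ∀ i, 0 < l i := fun i => zero_lt_one.trans (hl i)
  have hinv : ∀ i, (l i)⁻¹ < 1 := fun i => inv_lt_one_of_one_lt₀ (hl i)
  apply Set.Subset.antisymm
  · refine convexHull_min ?_ ?_
    · rintro T ⟨t, ht, hT⟩
      refine ⟨by simp [hT], Set.mem_iInter.2 fun a => ?_⟩
      have hsum := sum_prod_ite_mul_prod_ite t fun i => if a i then l i else (l i)⁻¹
      have hsign : (-1 : ℝ) ^ k = ∏ _i : Fin k, (-1 : ℝ) := by simp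
      simp only [Set.mem_ofPred_eq, hT, hsum]
      rw [hsign, ← prod_mul_distrib, ← prod_mul_distrib]
      refine prod_nonneg fun i _ => ?_
      have h1 := (ht i).1
      have h2 := (ht i).2
      have h3 := hpos i
      cases a i
      · have := mul_le_mul_of_nonneg_left h2 (inv_pos.2 h3).le
        rw [inv_mul_cancel₀ h3.ne'] at this
        simpa using this
      · have := mul_le_mul_of_nonneg_left h1 h3.le
        rw [mul_inv_cancel₀ h3.ne'] at this
        simpa using this
    · refine Convex.inter (convex_hyperplane (f := fun T : (Fin k → Bool) → ℝ => T _)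
        ⟨fun _ _ => rfl, fun _ _ => rfl⟩ _) (convex_iInter fun a => ?_)
      refine convex_halfSpace_ge ⟨fun S T => ?_, fun c T => ?_⟩ 0
      · simp only [Pi.add_apply, add_mul, sum_add_distrib, mul_add]
      · simp only [Pi.smul_apply, smul_eq_mul, mul_assoc, ← mul_sum]
        ring
  · rintro T ⟨hT0, hT⟩
    rw [Set.mem_iInter] at hT
    set d : (Fin k → Bool) → ℝ := fun a =>
      ∏ i, ((if a i then (1 : ℝ) else -1) * ((if a i then l i else (l i)⁻¹) ^ 2 - 1)) with hd
    set w : (Fin k → Bool) → ℝ := fun a =>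
      (∑ x, T x * ∏ i, (-(if a i then (1 : ℝ) else -1) *
        (if x i then -(if a i then l i else (l i)⁻¹) else 1))) / d a with hw
    set V : (Fin k → Bool) → (Fin k → Bool) → ℝ := fun a y =>
      ∏ i, if y i then (if a i then l i else (l i)⁻¹) else 1 with hV
    have hd0 : ∀ a, 0 ≤ d a := fun a => prod_nonneg fun i _ => by
      have h1 := hl i
      have h2 := hinv i
      have h3 := inv_pos.2 (hpos i)
      cases a i
      · simp only [Bool.false_eq_true, if_false]
        nlinarith
      · simp only [if_true]
        nlinarith
    have hw0 : ∀ a, 0 ≤ w a := fun a => div_nonneg (by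
      have := hT a
      rwa [Set.mem_ofPred_eq, sign_mul_sum_eq_sum_mul_prod] at this) (hd0 a)
    have key : ∀ y, ∑ a, w a * V a y = T y := fun y => by
      calc ∑ a, w a * V a y
          = ∑ a : Fin k → Bool, ∑ x : Fin k → Bool, T x * ∏ i,
            ((-(if a i then (1 : ℝ) else -1) *
              (if x i then -(if a i then l i else (l i)⁻¹) else 1)) /
            ((if a i then (1 : ℝ) else -1) * ((if a i then l i else (l i)⁻¹) ^ 2 - 1)) *
            (if y i then (if a i then l i else (l i)⁻¹) else 1)) := by
            refine sum_congr rfl fun a _ => ?_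
            simp only [hw, hV, hd, sum_div, sum_mul]
            refine sum_congr rfl fun x _ => ?_
            rw [prod_mul_distrib (g := fun i => if y i then _ else _), prod_div_distrib]
            ring
        _ = T y := by
            rw [sum_comm]
            simp only [← mul_sum, sum_prod_dual hl]
            simp
    have hTV : T = ∑ a, w a • V a := by
      ext y
      simp [key y]
    rw [hTV]
    refine (convex_convexHull ℝ _).sum_mem (fun a _ => hw0 a) ?_ fun a _ => subset_convexHull ℝ _
      ⟨fun i => if a i then l i else (l i)⁻¹, fun i => ?_, fun x => rfl⟩
    · have := key fun _ => false
      rw [hT0] at this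
      simpa [hV] using this
    · have := (hinv i).trans (hl i)
      dsimp only
      cases a i <;> simp [this.le]
end

section
/- Fix integers k ≥ 1 and a real λ ≥ 1. For every finite transcript set 𝒯, every protocol-compatible protocol P over 𝒯 that is λ-differentially private for every party, and every row-stochastic decision rule Q ∈ [0,1]^{𝒯×{0,1}}, the average accuracy for computing the XOR function f_0(x) = x_1 ⊕ ⋯ ⊕ x_k with 0–1 accuracy weights satisfies 2^{-k} ∑_{x∈{0,1}^k} ∑_{τ∈𝒯} P_{x,τ} Q_{τ, ⊕x} ≤ ( ∑_{i=0}^{⌊k/2⌋} C(k,2i) λ^{k−2i} ) / (1+λ)^k, where ⊕x denotes x_1 ⊕ ⋯ ⊕ x_k and C(k,2i) is the binomial coefficient. -/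
open Finset

/-- The XOR of the coordinates of `x ∈ {0,1}^k`. -/
def xorBits {k : ℕ} (x : Fin k → Bool) : Bool :=
  decide ((Finset.univ.filter fun i => x i = true).card % 2 = 1)

/-- The sum of a function over the even numbers up to `n`, indexed by their halves. -/
theorem sum_range_filter_even {M : Type*} [AddCommMonoid M] (n : ℕ) (f : ℕ → M) :
    ∑ m ∈ (range (n + 1)).filter Even, f m = ∑ i ∈ range (n / 2 + 1), f (2 * i) := by
  refine sum_nbij' (fun m => m / 2) (fun i => 2 * i) ?_ ?_ ?_ ?_ ?_
  · intro m hm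
    simp only [mem_filter, mem_range] at hm ⊢
    omega
  · intro i hi
    simp only [mem_filter, mem_range] at hi ⊢
    exact ⟨by omega, even_two_mul i⟩
  · intro m hm
    exact Nat.two_mul_div_two_of_even (mem_filter.1 hm).2
  · intro i _
    omega
  · intro m hm
    rw [Nat.two_mul_div_two_of_even (mem_filter.1 hm).2]

/-- The even part of the binomial expansion of `(1 + a) ^ n`, with exponents of `1` even. -/
theorem two_mul_sum_choose_even (a : ℝ) (n : ℕ) :
    2 * ∑ i ∈ range (n / 2 + 1), (n.choose (2 * i) : ℝ) * a ^ (n - 2 * i) =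
      (1 + a) ^ n + (a - 1) ^ n := by
  rw [← sum_range_filter_even n fun m => (n.choose m : ℝ) * a ^ (n - m), sum_filter,
    sub_eq_neg_add, add_pow, add_pow, ← sum_add_distrib, mul_sum]
  refine sum_congr rfl fun m _ => ?_
  rcases Nat.even_or_odd m with h | h
  · rw [if_pos h, h.neg_one_pow]
    ring
  · rw [if_neg (Nat.not_even_iff_odd.2 h), h.neg_one_pow]
    ring

/-- The sign `(-1) ^ (⊕ x)` is the product of the signs of the coordinates. -/
theorem prod_sign_eq_xorBits {k : ℕ} (x : Fin k → Bool) :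
    ∏ i, (if x i = true then (-1 : ℝ) else 1) = if xorBits x = true then -1 else 1 := by
  rw [prod_ite, prod_const, prod_const_one, mul_one, xorBits]
  rcases Nat.even_or_odd (univ.filter fun i => x i = true).card with h | h
  · simp [h.neg_one_pow, Nat.even_iff.1 h]
  · simp [h.neg_one_pow, Nat.odd_iff.1 h]

theorem sum_prod_bool {k : ℕ} (u : Fin k → Bool → ℝ) :
    ∑ x : Fin k → Bool, ∏ i, u i (x i) = ∏ i, (u i false + u i true) := by
  have h := prod_univ_sum (fun _ : Fin k => (univ : Finset Bool)) u
  rw [Fintype.piFinset_univ] at h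
  rw [← h]
  exact prod_congr rfl fun i _ => by simp [add_comm]

theorem sum_sign_mul_prod {k : ℕ} (u : Fin k → Bool → ℝ) :
    ∑ x : Fin k → Bool, (if xorBits x = true then (-1 : ℝ) else 1) * ∏ i, u i (x i) =
      ∏ i, (u i false - u i true) := by
  have h := sum_prod_bool fun i b => (if b = true then (-1 : ℝ) else 1) * u i b
  simp only [prod_mul_distrib, prod_sign_eq_xorBits] at h
  rw [h]
  exact prod_congr rfl fun i _ => by simp [sub_eq_add_neg]

/-- A nonzero product function with bounded ratios has factors with bounded ratios. -/
theorem factor_le_of_prod_le {k : ℕ} {lam : ℝ} (u : Fin k → Bool → ℝ)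
    (hu : ∀ i b, 0 ≤ u i b)
    (hdp : ∀ (i : Fin k) (x x' : Fin k → Bool), (∀ j, j ≠ i → x j = x' j) →
      ∏ j, u j (x j) ≤ lam * ∏ j, u j (x' j))
    (x : Fin k → Bool) (hx : ∏ j, u j (x j) ≠ 0) (i : Fin k) (b c : Bool) :
    u i b ≤ lam * u i c := by
  have hprod : ∀ d, ∏ j, u j (Function.update x i d j) =
      u i d * ∏ j ∈ univ.erase i, u j (x j) := by
    intro d
    rw [← mul_prod_erase univ _ (mem_univ i), Function.update_self]
    congr 1
    refine prod_congr rfl fun j hj => ?_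
    rw [Function.update_of_ne (ne_of_mem_erase hj)]
  have hpos : 0 < ∏ j ∈ univ.erase i, u j (x j) :=
    prod_pos fun j _ => (hu j _).lt_of_ne' fun h0 => hx (prod_eq_zero (mem_univ j) h0)
  have h := hdp i (Function.update x i b) (Function.update x i c) fun j hj => by
    rw [Function.update_of_ne hj, Function.update_of_ne hj]
  rw [hprod, hprod, ← mul_assoc] at h
  exact le_of_mul_le_mul_right h hpos

/-- The XOR bias of a product function with bounded ratios. -/
theorem abs_sum_sign_mul_prod_le {k : ℕ} {lam : ℝ} (hlam : 1 ≤ lam) (u : Fin k → Bool → ℝ)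
    (hu : ∀ i b, 0 ≤ u i b)
    (hdp : ∀ (i : Fin k) (x x' : Fin k → Bool), (∀ j, j ≠ i → x j = x' j) →
      ∏ j, u j (x j) ≤ lam * ∏ j, u j (x' j)) :
    |∑ x : Fin k → Bool, (if xorBits x = true then (-1 : ℝ) else 1) * ∏ i, u i (x i)| ≤
      ((lam - 1) / (1 + lam)) ^ k * ∑ x : Fin k → Bool, ∏ i, u i (x i) := by
  by_cases h : ∀ x : Fin k → Bool, ∏ i, u i (x i) = 0
  · simp [h]
  push Not at h
  obtain ⟨x, hx⟩ := h
  have hratio := factor_le_of_prod_le u hu hdp x hx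
  have hcard : ((lam - 1) / (1 + lam)) ^ k = ∏ _i : Fin k, (lam - 1) / (1 + lam) := by
    rw [prod_const, card_univ, Fintype.card_fin]
  rw [sum_sign_mul_prod, sum_prod_bool, abs_prod, hcard, ← prod_mul_distrib]
  refine prod_le_prod (fun i _ => abs_nonneg _) fun i _ => ?_
  have h₁ := hratio i false true
  have h₂ := hratio i true false
  rw [div_mul_eq_mul_div, le_div_iff₀ (by linarith)]
  rcases abs_cases (u i false - u i true) with ⟨h, _⟩ | ⟨h, _⟩ <;> rw [h] <;> nlinarith

/-- **Upper bound on the average accuracy of private multi-party XOR computation.**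
For any protocol-compatible protocol that is `λ`-differentially private for every party
and any row-stochastic decision rule, the average accuracy for computing the XOR of the
`k` bits with 0–1 accuracy weights is at most
`(∑_{i=0}^{⌊k/2⌋} C(k,2i) λ^{k−2i}) / (1+λ)^k`. -/
theorem xor_average_accuracy_upper_bound (k : ℕ) (hk : 1 ≤ k)
    (lam : ℝ) (hlam : 1 ≤ lam)
    (T : Type*) [Fintype T] (P : (Fin k → Bool) → T → ℝ)
    (hPnn : ∀ x τ, 0 ≤ P x τ)
    (hProw : ∀ x, ∑ τ, P x τ = 1)
    (hPcompat : ∀ τ : T, ∃ u : Fin k → Bool → ℝ,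
      (∀ i b, 0 ≤ u i b) ∧ ∀ x, P x τ = ∏ i, u i (x i))
    (hPdp : ∀ (i : Fin k) (x x' : Fin k → Bool) (τ : T),
      (∀ j, j ≠ i → x j = x' j) → P x τ ≤ lam * P x' τ)
    (Q : T → Bool → ℝ)
    (hQnn : ∀ τ b, 0 ≤ Q τ b) (hQrow : ∀ τ, Q τ false + Q τ true = 1) :
    (2 : ℝ) ^ (-(k : ℤ)) * ∑ x : Fin k → Bool, ∑ τ : T, P x τ * Q τ (xorBits x) ≤
      (∑ i ∈ Finset.range (k / 2 + 1), (k.choose (2 * i) : ℝ) * lam ^ (k - 2 * i)) /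
        (1 + lam) ^ k := by
  have hcol : ∀ τ, ∑ x, P x τ * Q τ (xorBits x) ≤
      (1 + ((lam - 1) / (1 + lam)) ^ k) / 2 * ∑ x, P x τ := by
    intro τ
    obtain ⟨u, hu, hPu⟩ := hPcompat τ
    have hbias := abs_sum_sign_mul_prod_le hlam u hu fun i x x' h => by
      simpa only [hPu] using hPdp i x x' τ h
    simp only [← hPu] at hbias
    have hsplit : ∑ x, P x τ * Q τ (xorBits x) = (∑ x, P x τ) / 2 +
        (Q τ false - Q τ true) *
          (∑ x, (if xorBits x = true then (-1 : ℝ) else 1) * P x τ) / 2 := by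
      rw [mul_sum, sum_div, sum_div, ← sum_add_distrib]
      refine sum_congr rfl fun x _ => ?_
      rcases xorBits x with _ | _
      · simp only [Bool.false_eq_true, if_false]
        linear_combination (P x τ / 2) * hQrow τ
      · simp only [if_true]
        linear_combination (P x τ / 2) * hQrow τ
    have hQabs : |Q τ false - Q τ true| ≤ 1 :=
      abs_le.2 ⟨by linarith [hQnn τ false, hQrow τ], by linarith [hQnn τ true, hQrow τ]⟩
    have hmul := (le_abs_self _).trans ((abs_mul (Q τ false - Q τ true) _).le.trans
      ((mul_le_of_le_one_left (abs_nonneg _) hQabs).trans hbias))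
    rw [hsplit]
    linarith
  have hmass : ∑ τ, ∑ x, P x τ = (2 : ℝ) ^ k := by
    rw [sum_comm]
    simp [hProw]
  calc (2 : ℝ) ^ (-(k : ℤ)) * ∑ x : Fin k → Bool, ∑ τ : T, P x τ * Q τ (xorBits x)
      ≤ (2 : ℝ) ^ (-(k : ℤ)) * ((1 + ((lam - 1) / (1 + lam)) ^ k) / 2 * 2 ^ k) := by
        rw [sum_comm, ← hmass, mul_sum univ _ ((1 + ((lam - 1) / (1 + lam)) ^ k) / 2)]
        exact mul_le_mul_of_nonneg_left (sum_le_sum fun τ _ => hcol τ) (by positivity)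
    _ = ((1 + lam) ^ k + (lam - 1) ^ k) / 2 / (1 + lam) ^ k := by
        rw [zpow_neg, zpow_natCast, div_pow]
        field_simp
    _ = _ := by
        rw [← two_mul_sum_choose_even, mul_div_cancel_left₀ _ two_ne_zero]
end

section
/- Fix a real λ ≥ 1 and consider the two-party randomized response R on {0,1}^2 with R_{x,x̃} = λ^{#\{i ∈ \{1,2\} : x̃_i = x_i\}}/(1+λ)^2, followed by the randomized decision rule f̂ that outputs 0 if x̃ = (0,0), outputs 1 if x̃ = (1,1), and if x̃ ∈ {(0,1),(1,0)} outputs 0 with probability λ/(1+λ) and 1 with probability 1/(1+λ). For x ∈ {0,1}^2 let A(x) = ∑_{x̃∈{0,1}^2} R_{x,x̃} · q_{x̃}(x_1 ∧ x_2), where q_{x̃}(y) is the probability that f̂ outputs y on input x̃. Then min_{x∈{0,1}^2} A(x) = λ(λ^2 + λ + 2)/(1+λ)^3; i.e., this randomized-response scheme achieves worst-case accuracy λ(λ^2+λ+2)/(1+λ)^3 for computing the two-party AND function. -/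
open Finset

theorem sum_fin_two_arrow_bool {M : Type*} [AddCommMonoid M] (f : (Fin 2 → Bool) → M) :
    ∑ x, f x = (f ![true, true] + f ![true, false]) + (f ![false, true] + f ![false, false]) := by
  rw [← (finTwoArrowEquiv Bool).symm.sum_comp]
  simp [Fintype.sum_prod_type, finTwoArrowEquiv]

/-- **Randomized response achieves the optimal two-party AND worst-case accuracy.**
For the two-party randomized response `R_{x,x̃} = λ^{#{i : x̃_i = x_i}}/(1+λ)²` followed by
the randomized decision rule outputting `0` on `(0,0)`, `1` on `(1,1)`, and `0` with
probability `λ/(1+λ)` (else `1`) on `(0,1)` or `(1,0)`, the worst-case probability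
(over the four inputs `x`) of correctly outputting `x_1 ∧ x_2` equals
`λ(λ²+λ+2)/(1+λ)³`. -/
theorem two_party_and_randomized_response_accuracy (lam : ℝ) (hlam : 1 ≤ lam)
    (R : (Fin 2 → Bool) → (Fin 2 → Bool) → ℝ)
    (hR : ∀ x xt, R x xt =
      lam ^ ((Finset.univ.filter fun i : Fin 2 => xt i = x i).card) / (1 + lam) ^ 2)
    (q : (Fin 2 → Bool) → Bool → ℝ)
    (hq : ∀ xt y, q xt y =
      if xt 0 = xt 1 then (if y = xt 0 then (1 : ℝ) else 0)
      else (if y then 1 / (1 + lam) else lam / (1 + lam))) :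
    Finset.univ.inf' Finset.univ_nonempty
        (fun x : Fin 2 → Bool => ∑ xt : Fin 2 → Bool, R x xt * q xt (x 0 && x 1))
      = lam * (lam ^ 2 + lam + 2) / (1 + lam) ^ 3 := by
  have hpos : 0 < 1 + lam := by linarith
  have accuracy_eq : ∀ a b : Bool, (a || b) = true →
      ∑ xt, R ![a, b] xt * q xt (a && b) = lam * (lam ^ 2 + lam + 2) / (1 + lam) ^ 3 := by
    intro a b hab
    rw [sum_fin_two_arrow_bool]
    cases a <;> cases b <;> simp [hR, hq, Finset.card_filter, Fin.sum_univ_two, -Finset.sum_boole] at hab ⊢ <;>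
      field_simp <;> ring
  have accuracy_zero :
      ∑ xt, R ![false, false] xt * q xt false = lam ^ 2 * (lam + 3) / (1 + lam) ^ 3 := by
    rw [sum_fin_two_arrow_bool]
    simp [hR, hq, Finset.card_filter, Fin.sum_univ_two, -Finset.sum_boole]
    field_simp
    ring
  apply le_antisymm
  · exact (Finset.inf'_le _ (Finset.mem_univ ![true, true])).trans_eq (accuracy_eq true true rfl)
  · refine Finset.le_inf' _ _ fun x _ => ?_
    obtain ⟨a, b, rfl⟩ : ∃ a b, x = ![a, b] := ⟨x 0, x 1, by ext i; fin_cases i <;> rfl⟩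
    by_cases hab : (a || b) = true
    · exact (accuracy_eq a b hab).ge
    · obtain ⟨rfl, rfl⟩ : a = false ∧ b = false := by simpa using hab
      refine le_trans ?_ accuracy_zero.ge
      gcongr ?_ / _
      nlinarith
end

section
/- Fix a real λ ≥ 1. For every finite transcript set 𝒯, every two-party protocol-compatible protocol P over 𝒯 (rows indexed by x ∈ {0,1}^2) that is λ-differentially private for both parties, and every row-stochastic decision rule Q ∈ [0,1]^{𝒯×{0,1}}, the worst-case accuracy for computing the AND function satisfies min_{x∈{0,1}^2} ∑_{τ∈𝒯} P_{x,τ} Q_{τ, x_1 ∧ x_2} ≤ λ(λ^2 + λ + 2)/(1+λ)^3. -/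
open Finset

/-- A product of two differences is nonnegative as soon as each difference is nonnegative after
scaling by the nonnegative entries of the vector behind the other one. -/
lemma mul_sub_mul_sub_nonneg_of_scaled {lam a a' b b' : ℝ}
    (ha : 0 ≤ a) (ha' : 0 ≤ a') (hb : 0 ≤ b) (hb' : 0 ≤ b')
    (hab : a' * b ≤ lam * (a * b)) (hab' : a' * b' ≤ lam * (a * b'))
    (hba : a * b' ≤ lam * (a * b)) (hba' : a' * b' ≤ lam * (a' * b)) :
    0 ≤ (lam * a - a') * (lam * b - b') := by
  have of_pos {c c' d : ℝ} (hd : 0 < d) (h : c' * d ≤ lam * (c * d)) : 0 ≤ lam * c - c' :=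
    sub_nonneg.2 (le_of_mul_le_mul_right (by linarith) hd)
  by_cases hb0 : b = 0 ∧ b' = 0
  · simp [hb0.1, hb0.2]
  by_cases ha0 : a = 0 ∧ a' = 0
  · simp [ha0.1, ha0.2]
  refine mul_nonneg ?_ ?_
  · rcases hb.lt_or_eq with h | h
    · exact of_pos h hab
    · exact of_pos (lt_of_le_of_ne hb' fun h' => hb0 ⟨h.symm, h'.symm⟩) hab'
  · rcases ha.lt_or_eq with h | h
    · exact of_pos h (by linarith)
    · exact of_pos (lt_of_le_of_ne ha' fun h' => ha0 ⟨h.symm, h'.symm⟩) (by linarith)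

/-- Dual certificate: the contribution of one transcript to the weighted accuracy on the inputs
`(1,1)`, `(0,1)`, `(1,0)` is at most a fixed linear functional of its column. -/
lemma weighted_accuracy_column_le {lam p00 p01 p10 p11 q0 q1 : ℝ}
    (hq0 : 0 ≤ q0) (hq1 : 0 ≤ q1) (hq : q0 + q1 = 1)
    (h0 : 0 ≤ p00 - lam * (p01 + p10) + lam ^ 2 * p11)
    (h1 : 0 ≤ lam ^ 2 * p00 - lam * (p01 + p10) + p11) :
    (lam ^ 2 - 1) * ((lam ^ 2 + 1) * (p11 * q1) + lam * (p01 * q0 + p10 * q0))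
      ≤ lam ^ 2 * p00 - lam * (p01 + p10) + lam ^ 4 * p11 := by
  obtain rfl : q0 = 1 - q1 := by linarith
  have e0 := mul_nonneg hq0 (mul_nonneg (sq_nonneg lam) h0)
  have e1 := mul_nonneg hq1 h1
  linear_combination e0 + e1

/-- **Upper bound on the worst-case accuracy of private two-party AND computation.**
For any two-party protocol-compatible protocol that is `λ`-differentially private for both
parties and any row-stochastic decision rule, the worst-case accuracy for computing the
AND of the two bits with 0–1 accuracy weights is at most `λ(λ²+λ+2)/(1+λ)³`. -/
theorem two_party_and_worst_case_upper_bound (lam : ℝ) (hlam : 1 ≤ lam)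
    (T : Type*) [Fintype T] (P : (Fin 2 → Bool) → T → ℝ)
    (hPnn : ∀ x τ, 0 ≤ P x τ)
    (hProw : ∀ x, ∑ τ, P x τ = 1)
    (hPcompat : ∀ τ : T, ∃ u : Fin 2 → Bool → ℝ,
      (∀ i b, 0 ≤ u i b) ∧ ∀ x, P x τ = ∏ i, u i (x i))
    (hPdp : ∀ (i : Fin 2) (x x' : Fin 2 → Bool) (τ : T),
      (∀ j, j ≠ i → x j = x' j) → P x τ ≤ lam * P x' τ)
    (Q : T → Bool → ℝ)
    (hQnn : ∀ τ b, 0 ≤ Q τ b) (hQrow : ∀ τ, Q τ false + Q τ true = 1) :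
    Finset.univ.inf' Finset.univ_nonempty
        (fun x : Fin 2 → Bool => ∑ τ : T, P x τ * Q τ (x 0 && x 1))
      ≤ lam * (lam ^ 2 + lam + 2) / (1 + lam) ^ 3 := by
  set A : (Fin 2 → Bool) → ℝ := fun x => ∑ τ : T, P x τ * Q τ (x 0 && x 1) with hA
  set m := Finset.univ.inf' Finset.univ_nonempty A
  have hm (x) : m ≤ A x := Finset.inf'_le _ (Finset.mem_univ x)
  have m11 := hm ![true, true]
  have m01 := hm ![false, true]
  have m10 := hm ![true, false]
  have dp0 (b c d : Bool) (τ : T) : P ![b, d] τ ≤ lam * P ![c, d] τ :=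
    hPdp 0 _ _ τ (by intro j hj; fin_cases j <;> simp_all)
  have dp1 (b c d : Bool) (τ : T) : P ![d, b] τ ≤ lam * P ![d, c] τ :=
    hPdp 1 _ _ τ (by intro j hj; fin_cases j <;> simp_all)
  rcases hlam.eq_or_lt with rfl | hlt
  · have hsum : A ![true, true] + A ![false, true] = 1 := by
      rw [← hProw ![true, true], hA, ← Finset.sum_add_distrib]
      refine Finset.sum_congr rfl fun τ _ => ?_
      have h : P ![false, true] τ = P ![true, true] τ :=
        le_antisymm (by simpa using dp0 false true true τ) (by simpa using dp0 true false true τ)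
      simp only [Matrix.cons_val_zero, Matrix.cons_val_one, Bool.and_true, h]
      linear_combination P ![true, true] τ * hQrow τ
    norm_num
    linarith
  · have product (b c : Bool) (τ : T) : 0 ≤ lam ^ 2 * P ![b, b] τ
        - lam * (P ![c, b] τ + P ![b, c] τ) + P ![c, c] τ := by
      obtain ⟨u, hu, hP⟩ := hPcompat τ
      have hP' (b c : Bool) : P ![b, c] τ = u 0 b * u 1 c := by simp [hP, Fin.prod_univ_two]
      have dp0' (b c d : Bool) := dp0 b c d τ
      have dp1' (b c d : Bool) := dp1 b c d τ
      simp only [hP'] at dp0' dp1' ⊢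
      linear_combination mul_sub_mul_sub_nonneg_of_scaled (hu 0 b) (hu 0 c)
        (hu 1 b) (hu 1 c) (dp0' c b b) (dp0' c b c) (dp1' c b b) (dp1' c b c)
    have column (τ : T) := weighted_accuracy_column_le (hQnn τ false) (hQnn τ true) (hQrow τ)
      (by linarith [product true false τ]) (product false true τ)
    have total := Finset.sum_le_sum fun τ (_ : τ ∈ Finset.univ) => column τ
    simp only [← Finset.mul_sum, Finset.sum_add_distrib, Finset.sum_sub_distrib, hProw] at total
    simp only [hA, Matrix.cons_val_zero, Matrix.cons_val_one, Bool.and_true, Bool.and_false]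
      at m11 m01 m10
    have hpos : 0 < lam - 1 := sub_pos.2 hlt
    have weighted : (lam ^ 2 + 1) * m + lam * (m + m) ≤ _ :=
      add_le_add (mul_le_mul_of_nonneg_left m11 (by positivity))
        (mul_le_mul_of_nonneg_left (add_le_add m01 m10) (by linarith))
    have scaled := mul_le_mul_of_nonneg_left weighted (by nlinarith : 0 ≤ lam ^ 2 - 1)
    rw [le_div_iff₀ (by positivity)]
    refine le_of_mul_le_mul_left ?_ hpos
    linear_combination scaled + total
end
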